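/- Let p be a prime with p > 3. If p ≡ 1 (mod 6), then Σ_{k=0}^{p−1} C(3k,k)·C(6k,3k) / (432^k (3k + 1)) ≡ (2^{p−1} + 2) / (3·2^{(p−1)/3}) (mod p²). If p ≡ 5 (mod 6), then Σ_{k=0}^{p−1} C(3k,k)·C(6k,3k) / (432^k (3k + 1)) ≡ 2^{(p+1)/3}·(2^{p−3} − 1) (mod p²). -/

import Mathlib

/-- A rational number is a `p`-integer if its denominator (in lowest terms)
is not divisible by `p`. -/
def isPInt (p : ℕ) (x : ℚ) : Prop := ¬ p ∣ x.den

/-- For `p`-integers `u, v`, `u ≡ v (mod p^k)` means `(u - v)/p^k` is a `p`-integer. -/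
def pCong (p k : ℕ) (u v : ℚ) : Prop := isPInt p ((u - v) / (p : ℚ) ^ k)

/-- The ring of rational `p`-integers. -/
def pIntegers (p : ℕ) [hp : Fact p.Prime] : Subring ℚ where
  carrier := {x | isPInt p x}
  mul_mem' {x y} hx hy h := by
    rcases (hp.out.dvd_mul).1 (h.trans (Rat.mul_den_dvd x y)) with h | h
    exacts [hx h, hy h]
  one_mem' h := hp.out.one_lt.ne' (by simpa using h)
  add_mem' {x y} hx hy h := by
    rcases (hp.out.dvd_mul).1 (h.trans (Rat.add_den_dvd x y)) with h | h
    exacts [hx h, hy h]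
  zero_mem' h := hp.out.one_lt.ne' (by simpa using h)
  neg_mem' {x} hx h := hx (by simpa using h)

section pIntegers

variable {p : ℕ} [hp : Fact p.Prime]

theorem inv_intCast_mem_pIntegers {m : ℤ} (h : ¬ (p : ℤ) ∣ m) : (m : ℚ)⁻¹ ∈ pIntegers p := by
  intro hd
  rw [Rat.inv_intCast_den] at hd
  split_ifs at hd with h0
  · exact h (h0 ▸ dvd_zero _)
  · exact h (Int.natCast_dvd.2 hd)

theorem inv_natCast_mem_pIntegers {m : ℕ} (h : ¬ p ∣ m) : (m : ℚ)⁻¹ ∈ pIntegers p := by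
  have := inv_intCast_mem_pIntegers (p := p) (m := m) (by exact_mod_cast h)
  simpa using this

theorem den_ne_zero_of_mem_pIntegers {x : ℚ} (hx : x ∈ pIntegers p) : (x.den : ZMod p) ≠ 0 :=
  fun h => hx ((ZMod.natCast_eq_zero_iff _ _).1 h)

theorem dvd_num_of_ratCast_eq_zero {x : ℚ} (hx : x ∈ pIntegers p) (h : (x : ZMod p) = 0) :
    (p : ℤ) ∣ x.num := by
  rw [Rat.cast_def, div_eq_zero_iff] at h
  exact (ZMod.intCast_zmod_eq_zero_iff_dvd _ _).1
    (h.resolve_right (den_ne_zero_of_mem_pIntegers hx))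

theorem ratCast_sum_of_mem {ι : Type*} (s : Finset ι) (f : ι → ℚ)
    (hf : ∀ i ∈ s, f i ∈ pIntegers p) :
    ((∑ i ∈ s, f i : ℚ) : ZMod p) = ∑ i ∈ s, (f i : ZMod p) := by
  classical
  induction s using Finset.induction_on with
  | empty => simp
  | insert a s ha ih =>
    rw [Finset.sum_insert ha, Finset.sum_insert ha, Rat.cast_add_of_ne_zero, ih]
    · exact fun i hi => hf i (Finset.mem_insert_of_mem hi)
    · exact den_ne_zero_of_mem_pIntegers (hf a (Finset.mem_insert_self a s))
    · exact den_ne_zero_of_mem_pIntegers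
        (sum_mem fun i hi => hf i (Finset.mem_insert_of_mem hi))

theorem ratCast_inv_natCast (m : ℕ) (h : ¬ p ∣ m) : (((m : ℚ)⁻¹ : ℚ) : ZMod p) = (m : ZMod p)⁻¹ := by
  have hm : (m : ZMod p) ≠ 0 := fun h0 => h ((ZMod.natCast_eq_zero_iff _ _).1 h0)
  rw [Rat.cast_inv_of_ne_zero] <;> simp [hm]

theorem pCong_of_eq {k : ℕ} {u v w : ℚ} (hw : w ∈ pIntegers p) (h : u - v = (p : ℚ) ^ k * w) :
    pCong p k u v := by
  have hp0 : (p : ℚ) ^ k ≠ 0 := pow_ne_zero _ (Nat.cast_ne_zero.2 hp.out.ne_zero)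
  rw [pCong, h, mul_div_cancel_left₀ _ hp0]
  exact hw

theorem pCong.exists_eq {k : ℕ} {u v : ℚ} (h : pCong p k u v) :
    ∃ w ∈ pIntegers p, u = v + (p : ℚ) ^ k * w := by
  have hp0 : (p : ℚ) ^ k ≠ 0 := pow_ne_zero _ (Nat.cast_ne_zero.2 hp.out.ne_zero)
  refine ⟨_, h, ?_⟩
  field_simp
  ring

theorem pCong.trans {k : ℕ} {u v w : ℚ} (h₁ : pCong p k u v) (h₂ : pCong p k v w) :
    pCong p k u w := by
  obtain ⟨a, ha, rfl⟩ := h₁.exists_eq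
  obtain ⟨b, hb, rfl⟩ := h₂.exists_eq
  exact pCong_of_eq (add_mem ha hb) (by ring)

theorem pCong.add {k : ℕ} {u v u' v' : ℚ} (h₁ : pCong p k u v) (h₂ : pCong p k u' v') :
    pCong p k (u + u') (v + v') := by
  obtain ⟨a, ha, rfl⟩ := h₁.exists_eq
  obtain ⟨b, hb, rfl⟩ := h₂.exists_eq
  exact pCong_of_eq (add_mem ha hb) (by ring)

theorem pCong_refl (k : ℕ) (u : ℚ) : pCong p k u u :=
  pCong_of_eq (zero_mem _) (by ring)

theorem pCong_sum {ι : Type*} {k : ℕ} (s : Finset ι) {f g : ι → ℚ}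
    (h : ∀ i ∈ s, pCong p k (f i) (g i)) : pCong p k (∑ i ∈ s, f i) (∑ i ∈ s, g i) := by
  classical
  induction s using Finset.induction_on with
  | empty => exact pCong_refl _ _
  | insert a s ha ih =>
    rw [Finset.sum_insert ha, Finset.sum_insert ha]
    exact (h a (Finset.mem_insert_self a s)).add
      (ih fun i hi => h i (Finset.mem_insert_of_mem hi))

theorem pCong_one_of_ratCast_eq {x y : ℚ} (hx : x ∈ pIntegers p) (hy : y ∈ pIntegers p)
    (h : (x : ZMod p) = y) : pCong p 1 x y := by
  have hxy := sub_mem hx hy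
  have h0 : ((x - y : ℚ) : ZMod p) = 0 := by
    rw [Rat.cast_sub_of_ne_zero (den_ne_zero_of_mem_pIntegers hx) (den_ne_zero_of_mem_pIntegers hy),
      h, sub_self]
  obtain ⟨m, hm⟩ := dvd_num_of_ratCast_eq_zero hxy h0
  refine pCong_of_eq (mul_mem (intCast_mem _ m) (inv_natCast_mem_pIntegers hxy)) ?_
  conv_lhs => rw [← Rat.num_div_den (x - y), hm]
  push_cast
  ring

/-- A product of `p`-adic one-units is linear modulo `p ^ 2`. -/
theorem pCong_prod_one_sub {ι : Type*} (s : Finset ι) (z : ι → ℚ)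
    (hz : ∀ i ∈ s, z i ∈ pIntegers p) :
    pCong p 2 (∏ i ∈ s, (1 - p * z i)) (1 - p * ∑ i ∈ s, z i) := by
  classical
  induction s using Finset.induction_on with
  | empty => exact pCong_of_eq (zero_mem _) (by simp)
  | insert a s ha ih =>
    have hs : ∀ i ∈ s, z i ∈ pIntegers p := fun i hi => hz i (Finset.mem_insert_of_mem hi)
    have hza := hz a (Finset.mem_insert_self a s)
    obtain ⟨w, hw, e⟩ := (ih hs).exists_eq
    rw [Finset.prod_insert ha, Finset.sum_insert ha, e]
    refine pCong_of_eq (w := z a * ∑ i ∈ s, z i + (1 - p * z a) * w) ?_ (by ring)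
    exact add_mem (mul_mem hza (sum_mem hs))
      (mul_mem (sub_mem (one_mem _) (mul_mem (natCast_mem _ p) hza)) hw)

end pIntegers

section ZModSums

theorem sum_range_eq_sum_zmod {p : ℕ} [NeZero p] {M : Type*} [AddCommMonoid M] (f : ZMod p → M) :
    ∑ k ∈ Finset.range p, f k = ∑ x, f x :=
  Finset.sum_bij (fun k _ => (k : ZMod p)) (fun _ _ => Finset.mem_univ _)
    (fun a ha b hb h => by
      have := congrArg ZMod.val h
      rwa [ZMod.val_cast_of_lt (Finset.mem_range.1 ha),
        ZMod.val_cast_of_lt (Finset.mem_range.1 hb)] at this)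
    (fun x _ => ⟨x.val, Finset.mem_range.2 x.val_lt, ZMod.natCast_zmod_val x⟩) fun _ _ => rfl

theorem sum_inv_eq_zero {K : Type*} [Field K] [Fintype K] (h2 : (2 : K) ≠ 0) :
    ∑ x : K, x⁻¹ = 0 := by
  have h : ∑ x : K, x⁻¹ = ∑ x : K, (-x)⁻¹ := (Equiv.sum_comp (Equiv.neg K) fun x => x⁻¹).symm
  simp only [inv_neg, Finset.sum_neg_distrib] at h
  have : 2 * ∑ x : K, x⁻¹ = 0 := by linear_combination h
  exact (mul_eq_zero.1 this).resolve_left h2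

theorem sum_inv_mul_three_mul_add_one {K : Type*} [Field K] [Fintype K] [DecidableEq K]
    (h2 : (2 : K) ≠ 0) (h3 : (3 : K) ≠ 0) :
    ∑ x : K, (x * (3 * x + 1))⁻¹ = 6 := by
  have hlin : ∑ x : K, (3 * x + 1)⁻¹ = 0 := by
    rw [← sum_inv_eq_zero h2]
    exact Equiv.sum_comp ((Equiv.mulLeft₀ (3 : K) h3).trans (Equiv.addRight 1)) fun x => x⁻¹
  have hdec (x : K) : (x * (3 * x + 1))⁻¹ =
      x⁻¹ - 3 * (3 * x + 1)⁻¹ + ((if x = 0 then 3 else 0) + if x = -3⁻¹ then 3 else 0) := by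
    by_cases hx : x = 0
    · simp [hx, h3]
    by_cases hy : x = -3⁻¹
    · simp [hy, h3]
    have : 3 * x + 1 ≠ 0 := fun h => hy (by field_simp; linear_combination h)
    simp only [hx, hy, if_false]
    have e₁ := mul_inv_cancel₀ hx
    have e₂ := mul_inv_cancel₀ this
    rw [mul_inv]
    linear_combination x⁻¹ * e₂ - (3 * x + 1)⁻¹ * 3 * e₁
  simp only [hdec, Finset.sum_add_distrib, Finset.sum_sub_distrib, ← Finset.mul_sum, hlin,
    sum_inv_eq_zero h2, Finset.sum_ite_eq', Finset.mem_univ, if_true]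
  norm_num

theorem sum_range_alternating_inv_two_mul {K : Type*} [Field K] (h2 : (2 : K) ≠ 0) (n : ℕ) :
    ∑ i ∈ Finset.range (2 * n), (-1 : K) ^ i * ((i + 1 : ℕ) : K)⁻¹ =
      ∑ i ∈ Finset.range n, ((n + 1 + i : ℕ) : K)⁻¹ := by
  induction n with
  | zero => simp
  | succ n ih =>
    have e₁ := Finset.sum_range_succ' (fun i => ((n + 1 + i : ℕ) : K)⁻¹) (n + 1)
    have e₂ : ((2 * n + 1 + 1 : ℕ) : K)⁻¹ = 2⁻¹ * ((n + 1 : ℕ) : K)⁻¹ := by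
      rw [← mul_inv]; congr 1; push_cast; ring
    have e₃ : ∑ i ∈ Finset.range (n + 1), ((n + 1 + 1 + i : ℕ) : K)⁻¹ =
        ∑ i ∈ Finset.range (n + 1), ((n + 1 + (i + 1) : ℕ) : K)⁻¹ :=
      Finset.sum_congr rfl fun i _ => by rw [add_right_comm, add_assoc]
    have e₄ : 2 * (2 : K)⁻¹ = 1 := mul_inv_cancel₀ h2
    rw [Finset.sum_range_succ, Finset.sum_range_succ, show n + 1 + (n + 1) = 2 * n + 1 + 1 by ring,
      show n + 1 + n = 2 * n + 1 by ring, add_zero] at e₁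
    rw [show 2 * (n + 1) = 2 * n + 1 + 1 by ring, Finset.sum_range_succ, Finset.sum_range_succ, ih,
      e₃, pow_succ, pow_mul, neg_one_sq, one_pow]
    linear_combination e₁ - 2 * e₂ - ((n + 1 : ℕ) : K)⁻¹ * e₄

theorem sum_range_alternating_inv_two_mul_add_one {K : Type*} [Field K] (h2 : (2 : K) ≠ 0) (n : ℕ) :
    ∑ i ∈ Finset.range (2 * n + 1), (-1 : K) ^ i * ((i + 1 : ℕ) : K)⁻¹ =
      ∑ i ∈ Finset.range (n + 1), ((n + 1 + i : ℕ) : K)⁻¹ := by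
  rw [Finset.sum_range_succ, Finset.sum_range_succ, sum_range_alternating_inv_two_mul h2, pow_mul,
    neg_one_sq, one_pow, one_mul, show n + 1 + n = 2 * n + 1 by ring]

variable {p : ℕ} [hp : Fact p.Prime]

theorem ZMod.two_ne_zero_of_odd_prime (h : 2 < p) : (2 : ZMod p) ≠ 0 := fun h0 => by
  have := (ZMod.natCast_eq_zero_iff 2 p).1 (by exact_mod_cast h0)
  exact absurd (Nat.le_of_dvd two_pos this) (by omega)

theorem choose_prime_sub_one (i : ℕ) (hi : i < p) :
    (((p - 1).choose i : ℕ) : ZMod p) = (-1) ^ i := by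
  induction i with
  | zero => simp
  | succ i ih =>
    have hpos := hp.out.pos
    have h1 : p.choose (i + 1) = (p - 1).choose i + (p - 1).choose (i + 1) := by
      conv_lhs => rw [← Nat.sub_add_cancel hpos]
      rw [Nat.choose_succ_succ]
    have h2 : ((p.choose (i + 1) : ℕ) : ZMod p) = 0 :=
      (ZMod.natCast_eq_zero_iff _ _).2 (hp.out.dvd_choose_self (by omega) hi)
    rw [h1, Nat.cast_add, ih (by omega)] at h2
    rw [pow_succ]
    linear_combination h2

/-- Eisenstein's congruence for the Fermat quotient `q` of `2`. -/
theorem sum_alternating_inv_eq_fermatQuotient {q : ℕ} (hq : 2 ^ (p - 1) = 1 + p * q) :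
    ∑ i ∈ Finset.range (p - 1), (-1 : ZMod p) ^ i * ((i + 1 : ℕ) : ZMod p)⁻¹ = 2 * q := by
  have hpos := hp.out.pos
  have hdvd : ∀ i ∈ Finset.range (p - 1), p * (p.choose (i + 1) / p) = p.choose (i + 1) := by
    intro i hi
    rw [Finset.mem_range] at hi
    exact Nat.mul_div_cancel' (hp.out.dvd_choose_self (by omega) (by omega))
  have hsum : 2 * q = ∑ i ∈ Finset.range (p - 1), p.choose (i + 1) / p := by
    apply Nat.eq_of_mul_eq_mul_left hpos
    rw [Finset.mul_sum, Finset.sum_congr rfl hdvd]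
    have h := Nat.sum_range_choose p
    rw [Finset.sum_range_succ, ← Nat.sub_add_cancel hpos, Finset.sum_range_succ'] at h
    simp only [Nat.sub_add_cancel hpos, Nat.choose_self, Nat.choose_zero_right] at h
    have h' : 2 ^ p = 2 * (1 + p * q) := by
      rw [← hq, ← pow_succ', Nat.sub_add_cancel hpos]
    linarith
  have hcast : (2 * q : ZMod p) = ((2 * q : ℕ) : ZMod p) := by push_cast; rfl
  rw [hcast, hsum, Nat.cast_sum]
  refine Finset.sum_congr rfl fun i hi => ?_
  have hi' := Finset.mem_range.1 hi
  have hne : ((i + 1 : ℕ) : ZMod p) ≠ 0 := fun h =>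
    absurd (Nat.le_of_dvd i.succ_pos ((ZMod.natCast_eq_zero_iff _ _).1 h)) (by omega)
  have hmul : (p.choose (i + 1) / p) * (i + 1) = (p - 1).choose i := by
    apply Nat.eq_of_mul_eq_mul_left hpos
    rw [← mul_assoc, hdvd i hi]
    have := Nat.add_one_mul_choose_eq (p - 1) i
    rw [Nat.sub_add_cancel hpos] at this
    exact this.symm
  rw [← choose_prime_sub_one i (by omega), ← hmul, Nat.cast_mul]
  field_simp

theorem sum_alternating_inv_add_reflect (h2 : 2 < p) {M N : ℕ} (h : M + N = p - 1) :
    ∑ i ∈ Finset.range (p - 1), (-1 : ZMod p) ^ i * ((i + 1 : ℕ) : ZMod p)⁻¹ =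
      ∑ i ∈ Finset.range M, (-1 : ZMod p) ^ i * ((i + 1 : ℕ) : ZMod p)⁻¹ +
      ∑ i ∈ Finset.range N, (-1 : ZMod p) ^ i * ((i + 1 : ℕ) : ZMod p)⁻¹ := by
  rw [← h, Finset.sum_range_add, ← Finset.sum_range_reflect _ N]
  congr 1
  refine Finset.sum_congr rfl fun i hi => ?_
  rw [Finset.mem_range] at hi
  have hodd : Odd p := hp.out.odd_of_ne_two (by omega)
  have hc : ((M + (N - 1 - i) + 1 : ℕ) : ZMod p) = -((i + 1 : ℕ) : ZMod p) := by
    rw [eq_neg_iff_add_eq_zero, ← Nat.cast_add, ZMod.natCast_eq_zero_iff]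
    exact ⟨1, by omega⟩
  have hpow : (-1 : ZMod p) ^ (M + (N - 1 - i)) = -(-1) ^ i := by
    rcases Nat.even_or_odd i with hi' | hi'
    · have : Odd (M + (N - 1 - i)) := by grind
      rw [this.neg_one_pow, hi'.neg_one_pow]
    · have : Even (M + (N - 1 - i)) := by grind
      rw [this.neg_one_pow, hi'.neg_one_pow, neg_neg]
  rw [hc, hpow, inv_neg, neg_mul_neg]

theorem sum_inv_Ico_symm_eq_zero (h2 : 2 < p) {a m : ℕ} (h : 2 * a + m = p + 1) :
    ∑ i ∈ Finset.range m, ((a + i : ℕ) : ZMod p)⁻¹ = 0 := by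
  have hr := Finset.sum_range_reflect (fun i => ((a + i : ℕ) : ZMod p)⁻¹) m
  have hn : ∑ i ∈ Finset.range m, ((a + (m - 1 - i) : ℕ) : ZMod p)⁻¹ =
      ∑ i ∈ Finset.range m, -((a + i : ℕ) : ZMod p)⁻¹ := by
    refine Finset.sum_congr rfl fun i hi => ?_
    rw [Finset.mem_range] at hi
    rw [← inv_neg]
    congr 1
    rw [eq_neg_iff_add_eq_zero, ← Nat.cast_add, ZMod.natCast_eq_zero_iff]
    exact ⟨1, by omega⟩
  rw [hn, Finset.sum_neg_distrib] at hr
  refine (mul_eq_zero.1 (?_ : 2 * _ = (0 : ZMod p))).resolve_left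
    (ZMod.two_ne_zero_of_odd_prime h2)
  linear_combination -hr

theorem sum_inv_eq_fermatQuotient_of_eq_six_mul_add_one (h2 : 2 < p) {n q : ℕ} (hn : p = 6 * n + 1)
    (hq : 2 ^ (p - 1) = 1 + p * q) :
    ∑ i ∈ Finset.range n, ((n + 1 + i : ℕ) : ZMod p)⁻¹ = 2 * q := by
  have h20 := ZMod.two_ne_zero_of_odd_prime h2
  rw [← sum_range_alternating_inv_two_mul h20, ← sum_alternating_inv_eq_fermatQuotient hq,
    sum_alternating_inv_add_reflect h2 (M := 2 * n) (N := 2 * (2 * n)) (by omega),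
    sum_range_alternating_inv_two_mul h20 (2 * n), sum_inv_Ico_symm_eq_zero h2 (by omega), add_zero]

theorem sum_inv_eq_fermatQuotient_of_eq_six_mul_add_five (h2 : 2 < p) {n q : ℕ} (hn : p = 6 * n + 5)
    (hq : 2 ^ (p - 1) = 1 + p * q) :
    ∑ i ∈ Finset.range (n + 1), ((n + 1 + i : ℕ) : ZMod p)⁻¹ = 2 * q := by
  have h20 := ZMod.two_ne_zero_of_odd_prime h2
  rw [← sum_range_alternating_inv_two_mul_add_one h20, ← sum_alternating_inv_eq_fermatQuotient hq,
    sum_alternating_inv_add_reflect h2 (M := 2 * n + 1) (N := 2 * (2 * n + 1) + 1) (by omega),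
    sum_range_alternating_inv_two_mul_add_one h20 (2 * n + 1),
    sum_inv_Ico_symm_eq_zero h2 (by omega), add_zero]

end ZModSums

/-- The coefficient of `x ^ k` in `₂F₁(-a, a + 1; 1; x)`. -/
def legendreCoeff (a : ℚ) (k : ℕ) : ℚ :=
  ∏ i ∈ Finset.range k, ((i - a) * (a + 1 + i) / (i + 1) ^ 2)

/-- The truncation at `m` of `₃F₂(-a, a + 1, 1/3; 1, 4/3; 1)`. -/
def legendreMoment (a : ℚ) (m : ℕ) : ℚ :=
  ∑ k ∈ Finset.range m, legendreCoeff a k / (3 * k + 1)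

/-- The coefficient of `x ^ k` in `₂F₁(-a, a; 1; x)`. -/
def contiguousCoeff (a : ℚ) (k : ℕ) : ℚ :=
  ∏ i ∈ Finset.range k, ((i - a) * (i + a) / (i + 1) ^ 2)

theorem legendreCoeff_succ (a : ℚ) (k : ℕ) :
    legendreCoeff a (k + 1) = legendreCoeff a k * ((k - a) * (a + 1 + k) / (k + 1) ^ 2) :=
  Finset.prod_range_succ _ _

theorem legendreCoeff_neg_one_sub (a : ℚ) : legendreCoeff (-1 - a) = legendreCoeff a :=
  funext fun k => Finset.prod_congr rfl fun i _ => by ring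

theorem legendreCoeff_neg_one_sixth_mul_factorial (k : ℕ) :
    432 ^ k * legendreCoeff (-1 / 6) k * (k.factorial * (2 * k).factorial * (3 * k).factorial) =
      (6 * k).factorial := by
  induction k with
  | zero => simp [legendreCoeff]
  | succ k ih =>
    rw [legendreCoeff_succ, show 2 * (k + 1) = 2 * k + 1 + 1 by ring,
      show 3 * (k + 1) = 3 * k + 1 + 1 + 1 by ring,
      show 6 * (k + 1) = 6 * k + 1 + 1 + 1 + 1 + 1 + 1 by ring]
    simp only [Nat.factorial_succ, Nat.cast_mul, ← ih]
    push_cast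
    field_simp
    ring

theorem choose_mul_choose_eq (k : ℕ) :
    ((3 * k).choose k : ℚ) * ((6 * k).choose (3 * k) : ℚ) = 432 ^ k * legendreCoeff (-1 / 6) k := by
  have h₁ := Nat.choose_mul_factorial_mul_factorial (show k ≤ 3 * k by omega)
  have h₂ := Nat.choose_mul_factorial_mul_factorial (show 3 * k ≤ 6 * k by omega)
  rw [show 3 * k - k = 2 * k by omega] at h₁
  rw [show 6 * k - 3 * k = 3 * k by omega] at h₂
  have h₁' : ((3 * k).choose k : ℚ) * k.factorial * (2 * k).factorial = (3 * k).factorial := by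
    exact_mod_cast h₁
  have h₂' : ((6 * k).choose (3 * k) : ℚ) * (3 * k).factorial * (3 * k).factorial =
      (6 * k).factorial := by exact_mod_cast h₂
  have h₃ := legendreCoeff_neg_one_sixth_mul_factorial k
  have hne : ((k.factorial : ℚ) * (2 * k).factorial * (3 * k).factorial) ≠ 0 := by positivity
  apply mul_right_cancel₀ hne
  rw [h₃, ← h₂', ← h₁']
  ring

theorem sum_choose_eq_legendreMoment (m : ℕ) :
    ∑ k ∈ Finset.range m,
      ((3 * k).choose k : ℚ) * ((6 * k).choose (3 * k) : ℚ) / (432 ^ k * (3 * (k : ℚ) + 1)) =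
      legendreMoment (-1 / 6) m :=
  Finset.sum_congr rfl fun k _ => by
    rw [choose_mul_choose_eq, mul_div_mul_left _ _ (by positivity)]

theorem mul_legendreCoeff_eq (a : ℚ) (k : ℕ) :
    a * legendreCoeff a k = (a + k) * contiguousCoeff a k := by
  induction k with
  | zero => simp [legendreCoeff, contiguousCoeff]
  | succ k ih =>
    rw [legendreCoeff_succ, ← mul_assoc, ih, contiguousCoeff, contiguousCoeff,
      Finset.prod_range_succ]
    push_cast
    ring

theorem mul_legendreCoeff_sub_one_eq (a : ℚ) (k : ℕ) :
    a * legendreCoeff (a - 1) k = (a - k) * contiguousCoeff a k := by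
  induction k with
  | zero => simp [legendreCoeff, contiguousCoeff]
  | succ k ih =>
    rw [legendreCoeff_succ, ← mul_assoc, ih, contiguousCoeff, contiguousCoeff,
      Finset.prod_range_succ]
    push_cast
    ring

theorem contiguousCoeff_succ (a : ℚ) (m : ℕ) :
    contiguousCoeff a (m + 1) =
      -(a ^ 2 / (m + 1) ^ 2) * ∏ i ∈ Finset.range m, (1 - a ^ 2 / ((i : ℚ) + 1) ^ 2) := by
  induction m with
  | zero => simp [contiguousCoeff]; ring
  | succ m ih =>
    rw [contiguousCoeff, Finset.prod_range_succ, ← contiguousCoeff, ih, Finset.prod_range_succ]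
    push_cast
    field_simp
    ring

theorem sum_contiguousCoeff (a : ℚ) (m : ℕ) :
    ∑ k ∈ Finset.range (m + 1), contiguousCoeff a k =
      ∏ i ∈ Finset.range m, (1 - a ^ 2 / ((i : ℚ) + 1) ^ 2) := by
  induction m with
  | zero => simp [contiguousCoeff]
  | succ m ih =>
    rw [Finset.sum_range_succ, ih, contiguousCoeff_succ, Finset.prod_range_succ]
    ring

theorem legendreMoment_recurrence {a : ℚ} (ha : a ≠ 0) (m : ℕ) :
    (3 * a + 1) * legendreMoment a (m + 1) = (3 * a - 1) * legendreMoment (a - 1) (m + 1) +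
      2 * ∏ i ∈ Finset.range m, (1 - a ^ 2 / ((i : ℚ) + 1) ^ 2) := by
  rw [← sum_contiguousCoeff, legendreMoment, legendreMoment, Finset.mul_sum, Finset.mul_sum,
    Finset.mul_sum, ← Finset.sum_add_distrib]
  refine Finset.sum_congr rfl fun k _ => ?_
  have h₁ := mul_legendreCoeff_eq a k
  have h₂ := mul_legendreCoeff_sub_one_eq a k
  have hk : (3 * (k : ℚ) + 1) * (3 * (k : ℚ) + 1)⁻¹ = 1 := mul_inv_cancel₀ (by positivity)
  apply mul_left_cancel₀ ha
  linear_combination (3 * a + 1) * (3 * (k : ℚ) + 1)⁻¹ * h₁ -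
    (3 * a - 1) * (3 * (k : ℚ) + 1)⁻¹ * h₂ + 2 * a * contiguousCoeff a k * hk

section

variable {p : ℕ} [hp : Fact p.Prime]

theorem inv_mem_pIntegers_of_lt {m : ℕ} (h0 : 0 < m) (h : m < p) : (m : ℚ)⁻¹ ∈ pIntegers p :=
  inv_natCast_mem_pIntegers fun hd => absurd (Nat.le_of_dvd h0 hd) (by omega)

theorem prod_one_sub_sq_div_sq {t : ℚ} (ht : t ∈ pIntegers p) {j : ℕ} (hj : 0 < j)
    (hjp : 2 * j < p) :
    ∃ w ∈ pIntegers p,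
      ∏ i ∈ Finset.range (p - 1), (1 - (p * t + j) ^ 2 / ((i : ℚ) + 1) ^ 2) = (p : ℚ) ^ 2 * w := by
  have hinv : ∀ i ∈ Finset.range (p - 1), ((i : ℚ) + 1)⁻¹ ∈ pIntegers p := by
    intro i hi
    rw [Finset.mem_range] at hi
    exact_mod_cast inv_mem_pIntegers_of_lt (p := p) i.succ_pos (by omega)
  have ha : (p * t + j : ℚ) ∈ pIntegers p :=
    add_mem (mul_mem (natCast_mem _ _) ht) (natCast_mem _ _)
  have hmem : ∀ i ∈ Finset.range (p - 1),
      (1 - (p * t + j) ^ 2 / ((i : ℚ) + 1) ^ 2) ∈ pIntegers p := by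
    intro i hi
    rw [div_eq_mul_inv, ← inv_pow]
    exact sub_mem (one_mem _) (mul_mem (pow_mem ha 2) (pow_mem (hinv i hi) 2))
  have hj₁ : j - 1 ∈ Finset.range (p - 1) := Finset.mem_range.2 (by omega)
  have hj₂ : p - j - 1 ∈ (Finset.range (p - 1)).erase (j - 1) :=
    Finset.mem_erase.2 ⟨by omega, Finset.mem_range.2 (by omega)⟩
  have e₁ : ((j - 1 : ℕ) : ℚ) + 1 = j := by
    rw [← Nat.cast_add_one, Nat.sub_add_cancel hj]
  have e₂ : ((p - j - 1 : ℕ) : ℚ) + 1 = p - j := by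
    rw [← Nat.cast_add_one, Nat.sub_add_cancel (by omega), Nat.cast_sub (by omega)]
  have hj₀ : (j : ℚ) ≠ 0 := Nat.cast_ne_zero.2 hj.ne'
  have hpj : (p - j : ℚ) ≠ 0 := by
    rw [← Nat.cast_sub (by omega)]
    exact Nat.cast_ne_zero.2 (by omega)
  have m₁ := hinv _ hj₁
  have m₂ := hinv _ (Finset.mem_of_mem_erase hj₂)
  rw [e₁] at m₁
  rw [e₂] at m₂
  rw [← Finset.mul_prod_erase _ _ hj₁, ← Finset.mul_prod_erase _ _ hj₂, e₁, e₂]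
  have hrest : ∏ i ∈ ((Finset.range (p - 1)).erase (j - 1)).erase (p - j - 1),
      (1 - (p * t + j) ^ 2 / ((i : ℚ) + 1) ^ 2) ∈ pIntegers p :=
    prod_mem fun i hi => hmem i (Finset.mem_of_mem_erase (Finset.mem_of_mem_erase hi))
  generalize ∏ i ∈ ((Finset.range (p - 1)).erase (j - 1)).erase (p - j - 1),
    (1 - (p * t + j) ^ 2 / ((i : ℚ) + 1) ^ 2) = P at hrest ⊢
  refine ⟨(-(t * (2 * j + p * t)) * (j : ℚ)⁻¹ ^ 2) *
    (((1 + t) * (p - 2 * j - p * t)) * ((p : ℚ) - j)⁻¹ ^ 2 * P), ?_, ?_⟩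
  · have n2 : (2 : ℚ) ∈ pIntegers p := ofNat_mem _ 2
    have np : (p : ℚ) ∈ pIntegers p := natCast_mem _ p
    have nj : (j : ℚ) ∈ pIntegers p := natCast_mem _ j
    refine mul_mem (mul_mem (neg_mem (mul_mem ht (add_mem (mul_mem n2 nj) (mul_mem np ht))))
      (pow_mem m₁ 2)) (mul_mem (mul_mem (mul_mem (add_mem (one_mem _) ht)
        (sub_mem (sub_mem np (mul_mem n2 nj)) (mul_mem np ht))) (pow_mem m₂ 2)) hrest)
  · field_simp
    ring

theorem legendreMoment_mul_prod {t : ℚ} (ht : t ∈ pIntegers p) (n : ℕ) (hn : 2 * n < p)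
    (h0 : ∀ j : ℕ, 0 < j → (p * t + j : ℚ) ≠ 0) :
    ∃ w ∈ pIntegers p,
      legendreMoment (p * t + n) p * ∏ i ∈ Finset.range n, (3 * (p * t + (i + 1)) + 1) =
      legendreMoment (p * t) p * ∏ i ∈ Finset.range n, (3 * (p * t + (i + 1)) - 1) +
        (p : ℚ) ^ 2 * w := by
  have hpt : (p * t : ℚ) ∈ pIntegers p := mul_mem (natCast_mem _ _) ht
  have n3 : (3 : ℚ) ∈ pIntegers p := ofNat_mem _ 3
  induction n with
  | zero => exact ⟨0, zero_mem _, by simp⟩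
  | succ n ih =>
    obtain ⟨w, hw, e⟩ := ih (by omega)
    obtain ⟨y, hy, e'⟩ := prod_one_sub_sq_div_sq ht n.succ_pos hn
    have hr := legendreMoment_recurrence (h0 _ n.succ_pos) (p - 1)
    rw [Nat.sub_add_cancel hp.out.pos, e'] at hr
    push_cast at hr ⊢
    rw [show (p * t + (n + 1) - 1 : ℚ) = p * t + n by ring] at hr
    rw [Finset.prod_range_succ, Finset.prod_range_succ]
    refine ⟨(3 * (p * t + (n + 1)) - 1) * w +
      2 * y * ∏ i ∈ Finset.range n, (3 * (p * t + (i + 1)) + 1), ?_, ?_⟩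
    · refine add_mem (mul_mem (sub_mem (mul_mem n3 (add_mem hpt (add_mem (natCast_mem _ _)
        (one_mem _)))) (one_mem _)) hw) (mul_mem (mul_mem (ofNat_mem _ 2) hy) (prod_mem fun i _ => ?_))
      exact add_mem (mul_mem n3 (add_mem hpt (add_mem (natCast_mem _ _) (one_mem _)))) (one_mem _)
    · linear_combination (∏ i ∈ Finset.range n, (3 * (p * t + ((i : ℚ) + 1)) + 1)) * hr +
        (3 * (p * t + (n + 1)) - 1) * e

theorem legendreCoeff_mul_prime {t : ℚ} (ht : t ∈ pIntegers p) (k : ℕ) (hk : k + 1 < p) :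
    ∃ w ∈ pIntegers p, legendreCoeff (p * t) (k + 1) =
      -(p * t) * ((k + 1 : ℕ) : ℚ)⁻¹ * (1 + p * t * ((k + 1 : ℕ) : ℚ)⁻¹) * (1 + (p : ℚ) ^ 2 * w) := by
  induction k with
  | zero => exact ⟨0, zero_mem _, by
      simp only [legendreCoeff, zero_add, Finset.prod_range_one]
      push_cast
      ring⟩
  | succ k ih =>
    obtain ⟨w, hw, e⟩ := ih (by omega)
    have hinv := inv_mem_pIntegers_of_lt k.succ_pos (show k + 1 < p by omega)
    refine ⟨w * (1 - (p * t * ((k + 1 : ℕ) : ℚ)⁻¹) ^ 2) - (t * ((k + 1 : ℕ) : ℚ)⁻¹) ^ 2, ?_, ?_⟩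
    · exact sub_mem (mul_mem hw (sub_mem (one_mem _) (pow_mem (mul_mem (mul_mem
        (natCast_mem _ _) ht) hinv) 2))) (pow_mem (mul_mem ht hinv) 2)
    · rw [legendreCoeff_succ, e]
      push_cast
      field_simp
      ring

theorem legendreMoment_mul_prime {t : ℚ} (ht : t ∈ pIntegers p) (hp3 : 3 < p) {k₀ c : ℕ}
    (hk₀ : 0 < k₀) (hk₀p : k₀ < p) (hc : ¬ p ∣ c) (h : 3 * k₀ + 1 = c * p) :
    pCong p 2 (legendreMoment (p * t) p)
      (1 + -(t * (c : ℚ)⁻¹ * (k₀ : ℚ)⁻¹) * (1 + p * t * (k₀ : ℚ)⁻¹) + -(p * t) * 6) := by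
  have hp0 : (p : ℚ) ≠ 0 := Nat.cast_ne_zero.2 hp.out.ne_zero
  have hmem0 : 0 ∈ Finset.range p := Finset.mem_range.2 hp.out.pos
  have hmem1 : k₀ ∈ (Finset.range p).erase 0 :=
    Finset.mem_erase.2 ⟨hk₀.ne', Finset.mem_range.2 hk₀p⟩
  set s := ((Finset.range p).erase 0).erase k₀ with hs
  have hinv : ∀ k, 0 < k → k < p → (k : ℚ)⁻¹ ∈ pIntegers p :=
    fun k h0 hlt => inv_mem_pIntegers_of_lt h0 hlt
  have hcop : Nat.Coprime p 3 := (Nat.coprime_primes hp.out Nat.prime_three).2 (by omega)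
  have hs_ndvd : ∀ k ∈ s, ¬ p ∣ k * (3 * k + 1) := by
    intro k hk hd
    simp only [hs, Finset.mem_erase, Finset.mem_range] at hk
    rcases hp.out.dvd_mul.1 hd with hd | hd
    · exact absurd (Nat.le_of_dvd (by omega) hd) (by omega)
    · have h₁ : (p : ℤ) ∣ 3 * (k - k₀ : ℤ) := by
        have h₂ : (p : ℤ) ∣ 3 * k + 1 := by exact_mod_cast hd
        have h₃ : (p : ℤ) ∣ 3 * k₀ + 1 := ⟨c, by exact_mod_cast h.trans (mul_comm c p)⟩
        have := dvd_sub h₂ h₃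
        rwa [show (3 * k + 1 - (3 * k₀ + 1) : ℤ) = 3 * (k - k₀) by ring] at this
      have h₄ : (p : ℤ) ∣ (k - k₀ : ℤ) :=
        Int.dvd_of_dvd_mul_right_of_gcd_one h₁ (by exact_mod_cast hcop)
      have h₅ := Int.eq_zero_of_abs_lt_dvd h₄ (by rw [abs_lt]; omega)
      omega
  have hs_mem : ∀ k ∈ s, ((k * (3 * k + 1) : ℕ) : ℚ)⁻¹ ∈ pIntegers p :=
    fun k hk => inv_natCast_mem_pIntegers (hs_ndvd k hk)
  have hcast : ((∑ k ∈ s, ((k * (3 * k + 1) : ℕ) : ℚ)⁻¹ : ℚ) : ZMod p) = ((6 : ℚ) : ZMod p) := by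
    have h2 := ZMod.two_ne_zero_of_odd_prime (p := p) (by omega)
    have h3 : (3 : ZMod p) ≠ 0 := fun h0 => by
      have := (ZMod.natCast_eq_zero_iff 3 p).1 (by exact_mod_cast h0)
      exact absurd (Nat.le_of_dvd three_pos this) (by omega)
    rw [ratCast_sum_of_mem s _ hs_mem, Finset.sum_congr rfl fun k hk =>
      ratCast_inv_natCast _ (hs_ndvd k hk)]
    have htot := sum_inv_mul_three_mul_add_one h2 h3
    rw [← sum_range_eq_sum_zmod, ← Finset.add_sum_erase _ _ hmem0,
      ← Finset.add_sum_erase _ _ hmem1, ← hs] at htot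
    have hz : (3 * k₀ + 1 : ZMod p) = 0 := by
      have : ((3 * k₀ + 1 : ℕ) : ZMod p) = 0 := by rw [h]; simp
      exact_mod_cast this
    rw [hz] at htot
    simp only [Nat.cast_zero, zero_mul, mul_zero, inv_zero, zero_add] at htot
    push_cast
    exact htot
  obtain ⟨v, hv, ev⟩ :=
    (pCong_one_of_ratCast_eq (sum_mem hs_mem) (ofNat_mem _ 6) hcast).exists_eq
  have hgen : pCong p 2 (∑ k ∈ s, legendreCoeff (p * t) k / (3 * k + 1))
      (∑ k ∈ s, -(p * t) * ((k * (3 * k + 1) : ℕ) : ℚ)⁻¹) := by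
    refine pCong_sum s fun k hk => ?_
    have hm := hs_mem k hk
    have hk' := hk
    simp only [hs, Finset.mem_erase, Finset.mem_range] at hk'
    obtain ⟨l, rfl⟩ := Nat.exists_eq_succ_of_ne_zero hk'.2.1
    obtain ⟨w, hw, e⟩ := legendreCoeff_mul_prime ht l hk'.2.2
    have hi := hinv _ l.succ_pos hk'.2.2
    rw [Nat.succ_eq_add_one] at *
    refine pCong_of_eq (w := -(t * ((((l + 1) * (3 * (l + 1) + 1) : ℕ) : ℚ)⁻¹) *
      (t * ((l + 1 : ℕ) : ℚ)⁻¹ * (1 + (p : ℚ) ^ 2 * w) + p * w))) ?_ ?_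
    · have np : (p : ℚ) ∈ pIntegers p := natCast_mem _ p
      exact neg_mem (mul_mem (mul_mem ht hm) (add_mem (mul_mem (mul_mem ht hi)
        (add_mem (one_mem _) (mul_mem (pow_mem np 2) hw))) (mul_mem np hw)))
    · rw [e]
      push_cast
      field_simp
      ring
  have hzero : legendreCoeff (p * t) 0 / (3 * (0 : ℕ) + 1) = 1 := by simp [legendreCoeff]
  have hspecial : pCong p 2 (legendreCoeff (p * t) k₀ / (3 * k₀ + 1))
      (-(t * (c : ℚ)⁻¹ * (k₀ : ℚ)⁻¹) * (1 + p * t * (k₀ : ℚ)⁻¹)) := by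
    have hi := hinv k₀ hk₀ hk₀p
    have hci : (c : ℚ)⁻¹ ∈ pIntegers p := inv_natCast_mem_pIntegers hc
    have hc0 : (c : ℚ) ≠ 0 := Nat.cast_ne_zero.2 fun h0 => hc (h0 ▸ dvd_zero p)
    have hden : (3 * k₀ + 1 : ℚ) = c * p := by exact_mod_cast h
    have hk0 : (k₀ : ℚ) ≠ 0 := Nat.cast_ne_zero.2 hk₀.ne'
    obtain ⟨w, hw, e⟩ := legendreCoeff_mul_prime ht (k₀ - 1) (by omega)
    rw [Nat.sub_add_cancel hk₀] at e
    have np : (p : ℚ) ∈ pIntegers p := natCast_mem _ p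
    refine pCong_of_eq (w := -(t * (c : ℚ)⁻¹ * (k₀ : ℚ)⁻¹) * (1 + p * t * (k₀ : ℚ)⁻¹) * w) ?_ ?_
    · exact mul_mem (mul_mem (neg_mem (mul_mem (mul_mem ht hci) hi))
        (add_mem (one_mem _) (mul_mem (mul_mem np ht) hi))) hw
    · rw [e, hden]
      field_simp
      ring
  rw [legendreMoment, ← Finset.add_sum_erase _ _ hmem0, ← Finset.add_sum_erase _ _ hmem1, ← hs,
    hzero, ← add_assoc]
  refine ((pCong_refl 2 1).add hspecial).add (hgen.trans ?_)
  rw [← Finset.mul_sum, ev]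
  exact pCong_of_eq (neg_mem (mul_mem ht hv)) (by ring)

end

theorem prod_range_linear_reflect (n : ℕ) (a b : ℚ) :
    ∏ i ∈ Finset.range n, (a * i + b) = ∏ i ∈ Finset.range n, (a * (n - 1 - i) + b) := by
  rw [← Finset.prod_range_reflect]
  refine Finset.prod_congr rfl fun i hi => ?_
  rw [Finset.mem_range] at hi
  rw [Nat.sub_sub, Nat.cast_sub (by omega)]
  push_cast
  ring

theorem prod_range_succ_add_eq_two_pow_mul (n : ℕ) :
    ∏ i ∈ Finset.range n, ((n : ℚ) + 1 + i) = 2 ^ n * ∏ i ∈ Finset.range n, (2 * (i : ℚ) + 1) := by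
  induction n with
  | zero => simp
  | succ n ih =>
    have h := Finset.prod_range_succ' (fun i => (n : ℚ) + 1 + (i : ℕ)) n
    have hc : ∏ i ∈ Finset.range n, ((n : ℚ) + 1 + (i + 1 : ℕ)) =
        ∏ i ∈ Finset.range n, (((n + 1 : ℕ) : ℚ) + 1 + i) :=
      Finset.prod_congr rfl fun i _ => by push_cast; ring
    rw [Finset.prod_range_succ, ih, hc] at h
    rw [Finset.prod_range_succ, Finset.prod_range_succ]
    push_cast at h ⊢
    linear_combination -2 * h

theorem prod_six_mul_sub_eq (x : ℚ) (n m : ℕ) :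
    ∏ i ∈ Finset.range m, (6 * ((n : ℚ) + 1 + i) - x) =
      6 ^ m * (∏ i ∈ Finset.range m, ((n : ℚ) + 1 + i)) *
        ∏ i ∈ Finset.range m, (1 - x * (6⁻¹ * ((n + 1 + i : ℕ) : ℚ)⁻¹)) := by
  rw [← Finset.card_range m, ← Finset.prod_const, Finset.card_range, ← Finset.prod_mul_distrib,
    ← Finset.prod_mul_distrib]
  refine Finset.prod_congr rfl fun i _ => ?_
  push_cast
  field_simp

theorem prod_neg_range (n : ℕ) (f : ℕ → ℚ) :
    ∏ i ∈ Finset.range n, -f i = (-1) ^ n * ∏ i ∈ Finset.range n, f i := by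
  rw [Finset.prod_neg, Finset.card_range]

theorem prod_six_mul_add_three (n : ℕ) :
    ∏ i ∈ Finset.range n, (6 * (i : ℚ) + 3) = 3 ^ n * ∏ i ∈ Finset.range n, (2 * (i : ℚ) + 1) := by
  rw [← Finset.card_range n, ← Finset.prod_const, Finset.card_range, ← Finset.prod_mul_distrib]
  exact Finset.prod_congr rfl fun i _ => by ring

theorem prod_div_of_eq_six_mul_add_one {x : ℚ} {n : ℕ} (hx : x = 6 * n + 1) :
    ∏ i ∈ Finset.range n, ((6 * i + (4 - x)) / (6 * i + (8 - x))) =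
      (2 - x) * (4 ^ n * ∏ i ∈ Finset.range n, (1 - x * (6⁻¹ * ((n + 1 + i : ℕ) : ℚ)⁻¹)))⁻¹ := by
  have hnum : ∏ i ∈ Finset.range n, (6 * (i : ℚ) + (4 - x)) =
      (-1) ^ n * (3 ^ n * ∏ i ∈ Finset.range n, (2 * (i : ℚ) + 1)) := by
    rw [prod_range_linear_reflect, ← prod_six_mul_add_three, ← prod_neg_range]
    exact Finset.prod_congr rfl fun i _ => by rw [hx]; ring
  have hden : (∏ i ∈ Finset.range n, (6 * (i : ℚ) + (8 - x))) * (2 - x) =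
      (-1) ^ n * ∏ i ∈ Finset.range n, (6 * ((n : ℚ) + 1 + i) - x) := by
    have h₁ : ∏ i ∈ Finset.range n, (6 * (i : ℚ) + (8 - x)) =
        (-1) ^ n * ∏ i ∈ Finset.range n, (6 * (i : ℚ) - 1) := by
      rw [prod_range_linear_reflect, ← prod_neg_range]
      exact Finset.prod_congr rfl fun i _ => by rw [hx]; ring
    have h₂ := Finset.prod_range_succ (fun i => 6 * ((i : ℕ) : ℚ) - 1) n
    have h₃ : ∏ i ∈ Finset.range n, (6 * ((i + 1 : ℕ) : ℚ) - 1) =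
        ∏ i ∈ Finset.range n, (6 * ((n : ℚ) + 1 + i) - x) :=
      Finset.prod_congr rfl fun i _ => by rw [hx]; push_cast; ring
    rw [Finset.prod_range_succ', h₃] at h₂
    rw [h₁]
    rw [Nat.cast_zero] at h₂
    have h₄ : 2 - x = -(6 * n - 1) := by rw [hx]; ring
    rw [h₄]
    linear_combination (-1) ^ n * h₂
  rw [prod_six_mul_sub_eq, prod_range_succ_add_eq_two_pow_mul] at hden
  have hD : ∏ i ∈ Finset.range n, (2 * (i : ℚ) + 1) ≠ 0 :=
    Finset.prod_ne_zero_iff.2 fun i _ => by positivity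
  have hx2 : 2 - x ≠ 0 := by
    rw [hx]
    intro h
    have h' : ((6 * n : ℕ) : ℚ) = ((1 : ℕ) : ℚ) := by push_cast; linear_combination -h
    have := Nat.cast_injective h'
    omega
  rw [Finset.prod_div_distrib, hnum, eq_div_of_mul_eq hx2 hden,
    show (6 : ℚ) ^ n = 3 ^ n * 2 ^ n by rw [← mul_pow]; norm_num,
    show (4 : ℚ) ^ n = 2 ^ n * 2 ^ n by rw [← mul_pow]; norm_num]
  generalize ∏ i ∈ Finset.range n, (2 * (i : ℚ) + 1) = D at hD
  generalize ∏ i ∈ Finset.range n, (1 - x * (6⁻¹ * ((n + 1 + i : ℕ) : ℚ)⁻¹)) = Z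
  field_simp

theorem prod_div_of_eq_six_mul_add_five {x : ℚ} {n : ℕ} (hx : x = 6 * n + 5) :
    ∏ i ∈ Finset.range n, ((6 * i + (4 - x)) / (6 * i + (8 - x))) =
      2 * 4 ^ n * (x - 2) *
        ∏ i ∈ Finset.range (n + 1), (1 - x * (6⁻¹ * ((n + 1 + i : ℕ) : ℚ)⁻¹)) := by
  have hden : ∏ i ∈ Finset.range n, (6 * (i : ℚ) + (8 - x)) =
      (-1) ^ n * (3 ^ n * ∏ i ∈ Finset.range n, (2 * (i : ℚ) + 1)) := by
    rw [prod_range_linear_reflect, ← prod_six_mul_add_three, ← prod_neg_range]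
    exact Finset.prod_congr rfl fun i _ => by rw [hx]; ring
  have hnum : ∏ i ∈ Finset.range n, (6 * (i : ℚ) + (4 - x)) =
      (-1) ^ n * ∏ i ∈ Finset.range (n + 1), (6 * ((n : ℚ) + 1 + i) - x) := by
    rw [prod_range_linear_reflect, Finset.prod_range_succ', hx, Nat.cast_zero,
      show (6 * ((n : ℚ) + 1 + 0) - (6 * n + 5)) = 1 by ring, mul_one, ← prod_neg_range]
    exact Finset.prod_congr rfl fun i _ => by push_cast; ring
  rw [prod_six_mul_sub_eq, Finset.prod_range_succ (fun i => (n : ℚ) + 1 + (i : ℕ)),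
    prod_range_succ_add_eq_two_pow_mul] at hnum
  have hD : ∏ i ∈ Finset.range n, (2 * (i : ℚ) + 1) ≠ 0 :=
    Finset.prod_ne_zero_iff.2 fun i _ => by positivity
  rw [Finset.prod_div_distrib, hnum, hden, pow_succ,
    show (6 : ℚ) ^ n = 3 ^ n * 2 ^ n by rw [← mul_pow]; norm_num,
    show (4 : ℚ) ^ n = 2 ^ n * 2 ^ n by rw [← mul_pow]; norm_num]
  generalize ∏ i ∈ Finset.range n, (2 * (i : ℚ) + 1) = D at hD
  generalize ∏ i ∈ Finset.range (n + 1), (1 - x * (6⁻¹ * ((n + 1 + i : ℕ) : ℚ)⁻¹)) = Z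
  rw [hx]
  field_simp
  ring

section

variable {p : ℕ} [hp : Fact p.Prime]

theorem inv_six_mem_pIntegers (hp3 : 3 < p) : (6 : ℚ)⁻¹ ∈ pIntegers p := by
  have h : ¬ p ∣ 6 := fun h => by
    rcases (hp.out.dvd_mul (m := 2) (n := 3)).1 h with h | h
    · exact absurd (Nat.le_of_dvd two_pos h) (by omega)
    · exact absurd (Nat.le_of_dvd three_pos h) (by omega)
  exact_mod_cast inv_natCast_mem_pIntegers h

theorem pCong_prod_of_sum_inv_eq (hp3 : 3 < p) {n m q : ℕ} (hnm : n + m < p)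
    (h : ∑ i ∈ Finset.range m, ((n + 1 + i : ℕ) : ZMod p)⁻¹ = 2 * q) :
    pCong p 2 (∏ i ∈ Finset.range m, (1 - (p : ℚ) * (6⁻¹ * ((n + 1 + i : ℕ) : ℚ)⁻¹)))
      (1 - p * q / 3) := by
  have h6 := inv_six_mem_pIntegers hp3
  have hlt : ∀ i ∈ Finset.range m, n + 1 + i < p := fun i hi => by
    rw [Finset.mem_range] at hi; omega
  have hmem : ∀ i ∈ Finset.range m, ((n + 1 + i : ℕ) : ℚ)⁻¹ ∈ pIntegers p := fun i hi =>
    inv_mem_pIntegers_of_lt (by omega) (hlt i hi)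
  have hcast : ((∑ i ∈ Finset.range m, ((n + 1 + i : ℕ) : ℚ)⁻¹ : ℚ) : ZMod p) =
      (((2 * q : ℕ) : ℚ) : ZMod p) := by
    rw [ratCast_sum_of_mem _ _ hmem, Finset.sum_congr rfl fun i hi => ratCast_inv_natCast _
      (fun hd => absurd (Nat.le_of_dvd (by omega) hd) (by have := hlt i hi; omega)), h,
      Rat.cast_natCast]
    push_cast
    rfl
  obtain ⟨v, hv, e⟩ :=
    (pCong_one_of_ratCast_eq (sum_mem hmem) (natCast_mem _ _) hcast).exists_eq
  refine (pCong_prod_one_sub _ _ fun i hi => mul_mem h6 (hmem i hi)).trans ?_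
  rw [← Finset.mul_sum, e]
  refine pCong_of_eq (neg_mem (mul_mem h6 hv)) ?_
  push_cast
  ring

theorem legendreMoment_pCong (hp3 : 3 < p) {n : ℕ} (hn : 6 * n < p) (h6 : p % 6 ≠ 0) {M : ℚ}
    (hM : pCong p 2 (legendreMoment (p * (-6⁻¹)) p) M) :
    pCong p 2 (legendreMoment (p * (-6⁻¹) + n) p)
      (M * ∏ i ∈ Finset.range n, ((6 * i + (4 - p)) / (6 * i + (8 - p)) : ℚ)) := by
  have ht : (-6⁻¹ : ℚ) ∈ pIntegers p := neg_mem (inv_six_mem_pIntegers hp3)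
  have h0 : ∀ j : ℕ, 0 < j → (p * (-6⁻¹) + j : ℚ) ≠ 0 := by
    intro j _ h
    have h' : ((6 * j : ℕ) : ℚ) = p := by push_cast; linear_combination 6 * h
    have := Nat.cast_injective h'
    omega
  have hodd : p % 2 = 1 := Nat.odd_iff.1 (hp.out.odd_of_ne_two (by omega))
  have hinv : ∀ i ∈ Finset.range n, (6 * i + (8 - p) : ℚ)⁻¹ ∈ pIntegers p := by
    intro i hi
    rw [Finset.mem_range] at hi
    have hnd : ¬ (p : ℤ) ∣ 6 * i + (8 - p) := by
      intro hd
      have := Int.eq_zero_of_abs_lt_dvd hd (by rw [abs_lt]; omega)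
      omega
    exact_mod_cast inv_intCast_mem_pIntegers hnd
  have hne : ∀ i ∈ Finset.range n, (6 * i + (8 - p) : ℚ) ≠ 0 := by
    intro i _ h
    have h' : ((6 * i + 8 : ℕ) : ℚ) = p := by push_cast; linear_combination h
    have := Nat.cast_injective h'
    omega
  obtain ⟨w, hw, e⟩ := legendreMoment_mul_prod ht n (by omega) h0
  obtain ⟨v, hv, e'⟩ := hM.exists_eq
  have hA : ∏ i ∈ Finset.range n, (3 * (p * (-6⁻¹) + ((i : ℚ) + 1)) + 1) =
      (2⁻¹) ^ n * ∏ i ∈ Finset.range n, (6 * i + (8 - p) : ℚ) := by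
    rw [← Finset.card_range n, ← Finset.prod_const, Finset.card_range, ← Finset.prod_mul_distrib]
    exact Finset.prod_congr rfl fun i _ => by ring
  have hB : ∏ i ∈ Finset.range n, (3 * (p * (-6⁻¹) + ((i : ℚ) + 1)) - 1) =
      (2⁻¹) ^ n * ∏ i ∈ Finset.range n, (6 * i + (4 - p) : ℚ) := by
    rw [← Finset.card_range n, ← Finset.prod_const, Finset.card_range, ← Finset.prod_mul_distrib]
    exact Finset.prod_congr rfl fun i _ => by ring
  have hAinv : (∏ i ∈ Finset.range n, (6 * i + (8 - p) : ℚ))⁻¹ ∈ pIntegers p := by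
    rw [← Finset.prod_inv_distrib]
    exact prod_mem hinv
  have hA0 := Finset.prod_ne_zero_iff.2 hne
  have hBmem : ∏ i ∈ Finset.range n, (6 * i + (4 - p) : ℚ) ∈ pIntegers p :=
    prod_mem fun i _ => add_mem (mul_mem (ofNat_mem _ 6) (natCast_mem _ i))
      (sub_mem (ofNat_mem _ 4) (natCast_mem _ p))
  rw [hA, hB, e'] at e
  rw [Finset.prod_div_distrib]
  generalize ∏ i ∈ Finset.range n, (6 * i + (8 - p) : ℚ) = A at *
  generalize ∏ i ∈ Finset.range n, (6 * i + (4 - p) : ℚ) = B at *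
  refine pCong_of_eq (w := (v * B + 2 ^ n * w) * A⁻¹) ?_ ?_
  · exact mul_mem (add_mem (mul_mem hv hBmem) (mul_mem (pow_mem (ofNat_mem _ 2) n) hw)) hAinv
  · have h2 : (2 : ℚ) ^ n * 2⁻¹ ^ n = 1 := by rw [← mul_pow]; norm_num
    have hAA : A * A⁻¹ = 1 := mul_inv_cancel₀ hA0
    rw [div_eq_mul_inv]
    generalize legendreMoment (p * (-6⁻¹) + n) p = L at *
    linear_combination 2 ^ n * A⁻¹ * e - L * hAA +
      (M + (p : ℚ) ^ 2 * v) * B * A⁻¹ * h2 - L * A * A⁻¹ * h2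

theorem exists_fermatQuotient_two (hp2 : 2 < p) : ∃ q : ℕ, 2 ^ (p - 1) = 1 + p * q := by
  have h : ((2 ^ (p - 1) : ℕ) : ZMod p) = ((1 : ℕ) : ZMod p) := by
    push_cast
    exact ZMod.pow_card_sub_one_eq_one (ZMod.two_ne_zero_of_odd_prime hp2)
  have h1 : 1 ≤ 2 ^ (p - 1) := Nat.one_le_two_pow
  obtain ⟨q, hq⟩ :=
    (Nat.modEq_iff_dvd' h1).1 ((ZMod.natCast_eq_natCast_iff _ _ _).1 h.symm)
  exact ⟨q, by omega⟩

theorem legendreMoment_pCong_of_eq_six_mul_add_one (hp3 : 3 < p) {n q : ℕ} (hn : p = 6 * n + 1)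
    (hq : 2 ^ (p - 1) = 1 + p * q) :
    pCong p 2 (legendreMoment (-1 / 6) p) ((1 + p * q / 3) / 4 ^ n) := by
  have h6 := inv_six_mem_pIntegers hp3
  have np : (p : ℚ) ∈ pIntegers p := natCast_mem _ p
  have nq : (q : ℚ) ∈ pIntegers p := natCast_mem _ q
  have hnq : (p : ℚ) = 6 * n + 1 := by exact_mod_cast hn
  have hn0 : (n : ℚ) ≠ 0 := Nat.cast_ne_zero.2 (by omega)
  have h2 : (2 : ℚ)⁻¹ ∈ pIntegers p := by
    exact_mod_cast inv_mem_pIntegers_of_lt (p := p) two_pos (by omega)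
  have hM : pCong p 2 (legendreMoment (p * (-6⁻¹)) p) ((2 + p) / 4) := by
    refine (legendreMoment_mul_prime (neg_mem h6) hp3 (k₀ := 2 * n) (c := 1) (by omega) (by omega)
      (by simpa using hp.out.one_lt.ne') (by omega)).trans ?_
    have hk : ((2 * n : ℕ) : ℚ)⁻¹ ∈ pIntegers p := inv_mem_pIntegers_of_lt (by omega) (by omega)
    refine pCong_of_eq (w := (3 * p - 4) * (6⁻¹ * ((2 * n : ℕ) : ℚ)⁻¹) ^ 2)
      (mul_mem (sub_mem (mul_mem (ofNat_mem _ 3) np) (ofNat_mem _ 4)) (pow_mem (mul_mem h6 hk) 2)) ?_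
    rw [hnq]
    push_cast
    field_simp
    ring
  have key := legendreMoment_pCong hp3 (n := n) (by omega) (by omega) hM
  rw [prod_div_of_eq_six_mul_add_one hnq,
    show (p * (-6⁻¹) + n : ℚ) = -1 / 6 by rw [hnq]; ring] at key
  refine key.trans ?_
  obtain ⟨v, hv, e⟩ := (pCong_prod_of_sum_inv_eq hp3 (by omega)
    (sum_inv_eq_fermatQuotient_of_eq_six_mul_add_one (by omega) hn hq)).exists_eq
  have hfac : ∀ i : ℕ, (1 - (p : ℚ) * (6⁻¹ * ((n + 1 + i : ℕ) : ℚ)⁻¹)) =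
      (6 * i + 5 : ℕ) * (6⁻¹ * ((n + 1 + i : ℕ) : ℚ)⁻¹) := by
    intro i
    rw [hnq]
    push_cast
    field_simp
    ring
  have hZ0 : ∏ i ∈ Finset.range n, (1 - (p : ℚ) * (6⁻¹ * ((n + 1 + i : ℕ) : ℚ)⁻¹)) ≠ 0 :=
    Finset.prod_ne_zero_iff.2 fun i _ => by rw [hfac]; positivity
  have hZinv : (∏ i ∈ Finset.range n, (1 - (p : ℚ) * (6⁻¹ * ((n + 1 + i : ℕ) : ℚ)⁻¹)))⁻¹ ∈
      pIntegers p := by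
    rw [← Finset.prod_inv_distrib]
    refine prod_mem fun i hi => ?_
    rw [Finset.mem_range] at hi
    rw [hfac, mul_inv, mul_inv, inv_inv, inv_inv]
    exact mul_mem (inv_mem_pIntegers_of_lt (by omega) (by omega))
      (mul_mem (ofNat_mem _ 6) (natCast_mem _ _))
  generalize ∏ i ∈ Finset.range n, (1 - (p : ℚ) * (6⁻¹ * ((n + 1 + i : ℕ) : ℚ)⁻¹)) = Z at *
  have h3 : (3 : ℚ)⁻¹ ∈ pIntegers p := by
    exact_mod_cast inv_mem_pIntegers_of_lt (p := p) three_pos hp3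
  refine pCong_of_eq (w := (2⁻¹ ^ 2) ^ n * Z⁻¹ *
    (-2⁻¹ ^ 2 + (q * 3⁻¹) ^ 2 - v * (1 + p * q * 3⁻¹))) ?_ ?_
  · exact mul_mem (mul_mem (pow_mem (pow_mem h2 2) n) hZinv) (sub_mem (add_mem
      (neg_mem (pow_mem h2 2)) (pow_mem (mul_mem nq h3) 2)) (mul_mem hv (add_mem (one_mem _)
      (mul_mem (mul_mem np nq) h3))))
  · have h4 : ((2⁻¹ : ℚ) ^ 2) ^ n = (4 ^ n)⁻¹ := by rw [← inv_pow]; norm_num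
    have hZZ : Z * Z⁻¹ = 1 := mul_inv_cancel₀ hZ0
    rw [h4, mul_inv, div_eq_mul_inv _ ((4 : ℚ) ^ n)]
    generalize ((4 : ℚ) ^ n)⁻¹ = F
    linear_combination F * (1 + p * q / 3) * hZZ - F * (1 + p * q / 3) * Z⁻¹ * e

theorem legendreMoment_pCong_of_eq_six_mul_add_five (hp3 : 3 < p) {n q : ℕ} (hn : p = 6 * n + 5)
    (hq : 2 ^ (p - 1) = 1 + p * q) :
    pCong p 2 (legendreMoment (-1 / 6) p) (4 ^ n * (p * q - 3)) := by
  have h6 := inv_six_mem_pIntegers hp3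
  have np : (p : ℚ) ∈ pIntegers p := natCast_mem _ p
  have nq : (q : ℚ) ∈ pIntegers p := natCast_mem _ q
  have hnq : (p : ℚ) = 6 * n + 5 := by exact_mod_cast hn
  have h2 : (2 : ℚ)⁻¹ ∈ pIntegers p := by
    exact_mod_cast inv_mem_pIntegers_of_lt (p := p) two_pos (by omega)
  have h3 : (3 : ℚ)⁻¹ ∈ pIntegers p := by
    exact_mod_cast inv_mem_pIntegers_of_lt (p := p) three_pos hp3
  have hM : pCong p 2 (legendreMoment (p * (-6⁻¹)) p) (3 * (2 + p) / 8) := by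
    refine (legendreMoment_mul_prime (neg_mem h6) hp3 (k₀ := 4 * n + 3) (c := 2) (by omega)
      (by omega) (fun hd => absurd (Nat.le_of_dvd two_pos hd) (by omega)) (by omega)).trans ?_
    have hk : ((4 * n + 3 : ℕ) : ℚ)⁻¹ ∈ pIntegers p := inv_mem_pIntegers_of_lt (by omega) (by omega)
    refine pCong_of_eq (w := (5 * p - 3) * (2⁻¹ * (3⁻¹ * ((4 * n + 3 : ℕ) : ℚ)⁻¹) ^ 2))
      (mul_mem (sub_mem (mul_mem (ofNat_mem _ 5) np) (ofNat_mem _ 3))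
        (mul_mem h2 (pow_mem (mul_mem h3 hk) 2))) ?_
    rw [hnq]
    push_cast
    field_simp
    ring
  have key := legendreMoment_pCong hp3 (n := n) (by omega) (by omega) hM
  rw [prod_div_of_eq_six_mul_add_five hnq,
    show (p * (-6⁻¹) + n : ℚ) = -1 - -1 / 6 by rw [hnq]; ring, legendreMoment,
    legendreCoeff_neg_one_sub, ← legendreMoment] at key
  refine key.trans ?_
  obtain ⟨v, hv, e⟩ := (pCong_prod_of_sum_inv_eq hp3 (by omega)
    (sum_inv_eq_fermatQuotient_of_eq_six_mul_add_five (by omega) hn hq)).exists_eq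
  rw [e]
  refine pCong_of_eq (w := 4 ^ n * (3 * 2⁻¹ ^ 2 * (1 - p * q * 3⁻¹ + (p : ℚ) ^ 2 * v) - 3 * v)) ?_ ?_
  · exact mul_mem (pow_mem (ofNat_mem _ 4) n) (sub_mem (mul_mem (mul_mem (ofNat_mem _ 3)
      (pow_mem h2 2)) (add_mem (sub_mem (one_mem _) (mul_mem (mul_mem np nq) h3))
      (mul_mem (pow_mem np 2) hv))) (mul_mem (ofNat_mem _ 3) hv))
  · ring

end

theorem stmt7 (p : ℕ) (hp : p.Prime) (hp3 : 3 < p) :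
    (p % 6 = 1 →
      pCong p 2
        (∑ k ∈ Finset.range p,
          ((3 * k).choose k : ℚ) * ((6 * k).choose (3 * k) : ℚ) / (432 ^ k * (3 * (k : ℚ) + 1)))
        (((2 : ℚ) ^ (p - 1) + 2) / (3 * (2 : ℚ) ^ ((p - 1) / 3)))) ∧
    (p % 6 = 5 →
      pCong p 2
        (∑ k ∈ Finset.range p,
          ((3 * k).choose k : ℚ) * ((6 * k).choose (3 * k) : ℚ) / (432 ^ k * (3 * (k : ℚ) + 1)))
        ((2 : ℚ) ^ ((p + 1) / 3) * ((2 : ℚ) ^ (p - 3) - 1))) := by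
  have : Fact p.Prime := ⟨hp⟩
  rw [sum_choose_eq_legendreMoment]
  obtain ⟨q, hq⟩ := exists_fermatQuotient_two (p := p) (by omega)
  have hq' : (2 : ℚ) ^ (p - 1) = 1 + p * q := by exact_mod_cast hq
  refine ⟨fun h => ?_, fun h => ?_⟩
  · obtain ⟨n, hn⟩ : ∃ n, p = 6 * n + 1 := ⟨p / 6, by omega⟩
    convert legendreMoment_pCong_of_eq_six_mul_add_one hp3 hn hq using 1
    rw [hq', show (p - 1) / 3 = 2 * n by omega, pow_mul]
    norm_num
    field_simp
    ring
  · obtain ⟨n, hn⟩ : ∃ n, p = 6 * n + 5 := ⟨p / 6, by omega⟩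
    convert legendreMoment_pCong_of_eq_six_mul_add_five hp3 hn hq using 1
    rw [show p - 1 = p - 3 + 2 by omega, pow_add] at hq'
    rw [show (p + 1) / 3 = 2 * (n + 1) by omega, pow_mul, pow_succ]
    norm_num
    linear_combination (4 : ℚ) ^ n * hq'
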